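/- arXiv:2107.01819 — 7 statements merged into one kernel-verified Lean document; each statement's English description precedes it below -/
import Mathlib

section
/- Let M be a symmetric positive definite real (p+1)×(p+1) matrix written in block form M = [[A, b],[bᵀ, d]] with A ∈ ℝ^{p×p}, b ∈ ℝ^p, d ∈ ℝ. Suppose that among all p×p principal submatrices of M (obtained by deleting the i-th row and the i-th column for some i), the submatrix A (deleting the last row and column) has maximal determinant. Then d − bᵀ A⁻¹ b ≤ (p+1) / trace(M⁻¹). -/
open Matrix

/-- The determinant of a matrix factors as that of its leading block times the Schur complement
of that block. -/
theorem Matrix.det_eq_det_submatrix_castSucc_mul {K : Type*} [Field K] {p : ℕ}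
    (M : Matrix (Fin (p + 1)) (Fin (p + 1)) K)
    (hA : (M.submatrix Fin.castSucc Fin.castSucc).det ≠ 0) :
    M.det = (M.submatrix Fin.castSucc Fin.castSucc).det *
      (M (Fin.last p) (Fin.last p) -
        (fun j => M (Fin.last p) (Fin.castSucc j)) ⬝ᵥ
          ((M.submatrix Fin.castSucc Fin.castSucc)⁻¹ *ᵥ
            fun i => M (Fin.castSucc i) (Fin.last p))) := by
  have := invertibleOfIsUnitDet _ hA.isUnit
  have hblock : M.submatrix finSumFinEquiv finSumFinEquiv =
      fromBlocks (M.submatrix Fin.castSucc Fin.castSucc)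
        (replicateCol (Fin 1) fun i => M (Fin.castSucc i) (Fin.last p))
        (replicateRow (Fin 1) fun j => M (Fin.last p) (Fin.castSucc j))
        (of fun _ _ => M (Fin.last p) (Fin.last p)) := by
    ext (i | i) (j | j) <;> try fin_cases i
    all_goals try fin_cases j
    all_goals rfl
  rw [← det_submatrix_equiv_self finSumFinEquiv M, hblock, det_fromBlocks₁₁, invOf_eq_nonsing_inv,
    Matrix.mul_assoc, ← replicateCol_mulVec, replicateRow_mul_replicateCol]
  simp

/-- A diagonal entry of the adjugate is the complementary principal minor. -/
theorem Matrix.adjugate_diag_eq_det_submatrix {R : Type*} [CommRing R] {p : ℕ}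
    (M : Matrix (Fin (p + 1)) (Fin (p + 1)) R) (i : Fin (p + 1)) :
    M.adjugate i i = (M.submatrix i.succAbove i.succAbove).det := by
  rw [adjugate_fin_succ_eq_det_submatrix, Even.neg_one_pow ⟨_, rfl⟩, one_mul]

/-- Let `M` be a symmetric positive definite real `(p+1)×(p+1)` matrix written
in block form `M = [[A, b],[bᵀ, d]]` with `A = M.submatrix castSucc castSucc` (delete the
last row and column), `b i = M i (last)`, `d = M (last) (last)`. If `A` has maximal
determinant among all `p×p` principal submatrices of `M` (deleting row `i` and column `i`),
then `d − bᵀ A⁻¹ b ≤ (p+1) / trace(M⁻¹)`. -/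
theorem schur_complement_le_of_maximal_principal_minor
    (p : ℕ) (M : Matrix (Fin (p + 1)) (Fin (p + 1)) ℝ) (hM : M.PosDef)
    (hmax : ∀ i : Fin (p + 1),
      (M.submatrix i.succAbove i.succAbove).det ≤
        (M.submatrix Fin.castSucc Fin.castSucc).det) :
    M (Fin.last p) (Fin.last p) -
        (fun i => M (Fin.castSucc i) (Fin.last p)) ⬝ᵥ
          ((M.submatrix Fin.castSucc Fin.castSucc)⁻¹ *ᵥ
            fun i => M (Fin.castSucc i) (Fin.last p)) ≤
      ((p : ℝ) + 1) / M⁻¹.trace := by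
  have hdet := hM.det_pos
  have hA : 0 < (M.submatrix Fin.castSucc Fin.castSucc).det :=
    (hM.submatrix (Fin.castSucc_injective p)).det_pos
  have hrow : (fun j => M (Fin.last p) (Fin.castSucc j)) =
      fun i => M (Fin.castSucc i) (Fin.last p) := by
    ext j
    simpa using hM.isHermitian.apply (Fin.castSucc j) (Fin.last p)
  have hschur := M.det_eq_det_submatrix_castSucc_mul hA.ne'
  rw [hrow] at hschur
  have htrace : M⁻¹.trace * M.det ≤
      ((p : ℝ) + 1) * (M.submatrix Fin.castSucc Fin.castSucc).det := by
    have hsum := Finset.sum_le_sum fun i (_ : i ∈ Finset.univ) => hmax i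
    simp_rw [← adjugate_diag_eq_det_submatrix] at hsum
    rw [inv_def, trace_smul, Ring.inverse_eq_inv', smul_eq_mul, mul_right_comm,
      inv_mul_cancel₀ hdet.ne', one_mul]
    simpa [trace] using hsum
  rw [le_div_iff₀ hM.inv.trace_pos]
  rw [hschur] at htrace
  nlinarith
end

section
/- Let p ≤ q be positive integers and let W ∈ ℝ^{p×(q+1)}. For i = 1,...,q+1 let W_i ∈ ℝ^{p×q} denote the submatrix of W obtained by deleting the i-th column. Then det(W Wᵀ) = (1/(q+1−p)) · Σ_{i=1}^{q+1} det(W_i W_iᵀ). -/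
open Matrix

namespace Matrix

variable {m n : Type*} [Fintype m] [DecidableEq m] [Fintype n]

/-- If `W * Wᵀ` is singular, so is the Gram matrix of any column submatrix of `W`. -/
theorem det_submatrix_mul_transpose_eq_zero {k : Type*} [Fintype k] (W : Matrix m n ℝ)
    (f : k → n) (h : (W * Wᵀ).det = 0) :
    (W.submatrix id f * (W.submatrix id f)ᵀ).det = 0 := by
  obtain ⟨v, hv, hvW⟩ := exists_vecMul_eq_zero_iff.mpr h
  refine exists_vecMul_eq_zero_iff.mp ⟨v, hv, ?_⟩
  have hW : v ᵥ* W = 0 := by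
    rw [← conjTranspose_eq_transpose_of_trivial, vecMul_self_mul_conjTranspose_eq_zero] at hvW
    exact hvW
  have hWf : v ᵥ* W.submatrix id f = 0 := funext fun j => congrFun hW (f j)
  rw [← vecMul_vecMul, hWf, zero_vecMul]

/-- The trace of the orthogonal projection onto the row space of a full-rank matrix. -/
theorem sum_col_dotProduct_inv_mulVec_col {K : Type*} [Field K] (W : Matrix m n K)
    (h : (W * Wᵀ).det ≠ 0) :
    ∑ i, W.col i ⬝ᵥ (W * Wᵀ)⁻¹ *ᵥ W.col i = Fintype.card m := by
  calc ∑ i, W.col i ⬝ᵥ (W * Wᵀ)⁻¹ *ᵥ W.col i = (Wᵀ * ((W * Wᵀ)⁻¹ * W)).trace := rfl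
    _ = Fintype.card m := by
      rw [trace_mul_comm, Matrix.mul_assoc, nonsing_inv_mul _ (isUnit_iff_ne_zero.mpr h), trace_one]

/-- Matrix determinant lemma for subtracting a symmetric rank-one matrix. -/
theorem det_sub_vecMulVec_self {K : Type*} [Field K] (A : Matrix m m K) (h : A.det ≠ 0)
    (w : m → K) : (A - vecMulVec w w).det = A.det * (1 - w ⬝ᵥ A⁻¹ *ᵥ w) := by
  have hdet := det_add_replicateCol_mul_replicateRow (ι := Unit)
    (isUnit_iff_ne_zero.mpr h) (-w) w
  rw [← vecMulVec_eq, neg_vecMulVec, ← sub_eq_add_neg] at hdet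
  rw [hdet, Matrix.mul_assoc, ← replicateCol_mulVec, det_unique (n := Unit), add_apply,
    one_apply_eq, replicateRow_mul_replicateCol_apply, mulVec_neg, dotProduct_neg, ← sub_eq_add_neg]

/-- Deleting a column changes the Gram matrix by a rank-one matrix. -/
theorem submatrix_succAbove_mul_transpose {l R : Type*} [CommRing R] {q : ℕ}
    (W : Matrix l (Fin (q + 1)) R) (i : Fin (q + 1)) :
    W.submatrix id i.succAbove * (W.submatrix id i.succAbove)ᵀ =
      W * Wᵀ - vecMulVec (W.col i) (W.col i) := by
  ext a b
  simp [mul_apply, Fin.sum_univ_succAbove _ i, vecMulVec_apply]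

end Matrix

/-- Let `p ≤ q` be positive integers and `W ∈ ℝ^{p×(q+1)}`. For each
`i`, let `W_i = W.submatrix id i.succAbove` be `W` with its `i`-th column deleted. Then
`det (W Wᵀ) = (1/(q+1−p)) · Σ_i det (W_i W_iᵀ)`. -/
theorem det_self_mul_transpose_eq_sum_column_deleted
    (p q : ℕ) (hp : 0 < p) (hpq : p ≤ q) (W : Matrix (Fin p) (Fin (q + 1)) ℝ) :
    (W * Wᵀ).det =
      (((q : ℝ) + 1 - p))⁻¹ *
        ∑ i : Fin (q + 1),
          ((W.submatrix id i.succAbove) * (W.submatrix id i.succAbove)ᵀ).det := by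
  by_cases h : (W * Wᵀ).det = 0
  · simp only [det_submatrix_mul_transpose_eq_zero W _ h, h, Finset.sum_const_zero, mul_zero]
  · simp only [submatrix_succAbove_mul_transpose, det_sub_vecMulVec_self _ h]
    rw [← Finset.mul_sum, Finset.sum_sub_distrib, sum_col_dotProduct_inv_mulVec_col W h]
    have hne : (q : ℝ) + 1 - p ≠ 0 := by
      have : (p : ℝ) ≤ q := by exact_mod_cast hpq
      linarith
    simp only [Finset.sum_const, Finset.card_univ, Fintype.card_fin, nsmul_eq_mul, mul_one]
    push_cast
    field_simp
end

section
/- Let p ≤ q be positive integers and let W ∈ ℝ^{p×(q+1)}. For i = 1,...,q+1 let W_i ∈ ℝ^{p×q} denote the submatrix of W obtained by deleting the i-th column, and suppose A = W_{i₀} is such that det(A Aᵀ) ≥ det(W_i W_iᵀ) for all i. Then det(W Wᵀ) ≤ ((q+1)/(q+1−p)) · det(A Aᵀ); equivalently, in terms of the p-volume vol(X) = √det(X Xᵀ), vol(W) ≤ (1 − p/(q+1))^{−1/2} · vol(A). -/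
open Matrix

theorem Matrix.submatrix_succAbove_mul_transpose_s10 {R : Type*} [CommRing R] {p q : ℕ}
    (W : Matrix (Fin p) (Fin (q + 1)) R) (i : Fin (q + 1)) :
    W.submatrix id i.succAbove * (W.submatrix id i.succAbove)ᵀ =
      W * Wᵀ + replicateCol Unit (-W.col i) * replicateRow Unit (W.col i) := by
  ext a b
  simp [Matrix.mul_apply, Fin.sum_univ_succAbove _ i, Matrix.col]

/-- The Cauchy–Binet identity for the column-deleted submatrices of a matrix whose Gram matrix
is invertible. -/
theorem Matrix.sum_det_submatrix_succAbove_mul_transpose {R : Type*} [CommRing R] {p q : ℕ}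
    (W : Matrix (Fin p) (Fin (q + 1)) R) (hW : IsUnit (W * Wᵀ).det) :
    ∑ i : Fin (q + 1), (W.submatrix id i.succAbove * (W.submatrix id i.succAbove)ᵀ).det =
      ((q : R) + 1 - p) * (W * Wᵀ).det := by
  have hdet (i : Fin (q + 1)) :
      (W.submatrix id i.succAbove * (W.submatrix id i.succAbove)ᵀ).det =
        (W * Wᵀ).det * (1 - (Wᵀ * (W * Wᵀ)⁻¹ * W) i i) := by
    rw [submatrix_succAbove_mul_transpose_s10, det_add_replicateCol_mul_replicateRow hW]
    congr 1
    simp [Matrix.mul_apply, Matrix.col, sub_eq_add_neg]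
  have htrace : (Wᵀ * (W * Wᵀ)⁻¹ * W).trace = p := by
    rw [Matrix.trace_mul_comm, ← Matrix.mul_assoc, Matrix.mul_nonsing_inv _ hW]
    simp
  simp only [hdet, ← Finset.mul_sum, Finset.sum_sub_distrib]
  rw [← htrace, mul_comm]
  simp [Matrix.trace]

theorem Matrix.det_self_mul_transpose_nonneg {m n : Type*} [Fintype m] [DecidableEq m] [Fintype n]
    (X : Matrix m n ℝ) : 0 ≤ (X * Xᵀ).det := by
  simpa using (Matrix.posSemidef_self_mul_conjTranspose X).det_nonneg

/-- Let `p ≤ q` be positive integers and `W ∈ ℝ^{p×(q+1)}`. Let `W_i` denote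
`W` with its `i`-th column deleted, and suppose `A = W_{i₀}` maximises `det (W_i W_iᵀ)`.
Then `det (W Wᵀ) ≤ ((q+1)/(q+1−p)) · det (A Aᵀ)`; equivalently, in terms of the `p`-volume
`vol X = √det(X Xᵀ)`, `vol W ≤ (1 − p/(q+1))^{−1/2} · vol A`. -/
theorem det_self_mul_transpose_le_of_maximal_column_deleted
    (p q : ℕ) (hp : 0 < p) (hpq : p ≤ q) (W : Matrix (Fin p) (Fin (q + 1)) ℝ)
    (i₀ : Fin (q + 1))
    (hmax : ∀ i : Fin (q + 1),
      ((W.submatrix id i.succAbove) * (W.submatrix id i.succAbove)ᵀ).det ≤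
        ((W.submatrix id i₀.succAbove) * (W.submatrix id i₀.succAbove)ᵀ).det) :
    (W * Wᵀ).det ≤
        (((q : ℝ) + 1) / ((q : ℝ) + 1 - p)) *
          ((W.submatrix id i₀.succAbove) * (W.submatrix id i₀.succAbove)ᵀ).det ∧
      Real.sqrt (W * Wᵀ).det ≤
        (Real.sqrt (1 - (p : ℝ) / ((q : ℝ) + 1)))⁻¹ *
          Real.sqrt ((W.submatrix id i₀.succAbove) * (W.submatrix id i₀.succAbove)ᵀ).det := by
  have hpq' : (p : ℝ) ≤ q := by exact_mod_cast hpq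
  have hd : (0 : ℝ) < (q : ℝ) + 1 - p := by linarith
  have hq : (0 : ℝ) < (q : ℝ) + 1 := by positivity
  have hA := Matrix.det_self_mul_transpose_nonneg (W.submatrix id i₀.succAbove)
  have hdet : (W * Wᵀ).det ≤
      (((q : ℝ) + 1) / ((q : ℝ) + 1 - p)) *
        ((W.submatrix id i₀.succAbove) * (W.submatrix id i₀.succAbove)ᵀ).det := by
    by_cases h : (W * Wᵀ).det = 0
    · rw [h]
      positivity
    · have hsum := Finset.sum_le_sum fun i (_ : i ∈ Finset.univ) => hmax i
      rw [Matrix.sum_det_submatrix_succAbove_mul_transpose W (isUnit_iff_ne_zero.mpr h)] at hsum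
      rw [div_mul_eq_mul_div, le_div_iff₀ hd, mul_comm]
      simpa using hsum
  refine ⟨hdet, ?_⟩
  have hratio : ((q : ℝ) + 1) / ((q : ℝ) + 1 - p) = (1 - (p : ℝ) / ((q : ℝ) + 1))⁻¹ := by
    rw [one_sub_div hq.ne', inv_div]
  rw [hratio] at hdet
  rw [← Real.sqrt_inv, ← Real.sqrt_mul' _ hA]
  exact Real.sqrt_le_sqrt hdet
end

section
/- Let p ≤ q and let M ∈ ℝ^{(p+1)×(q+1)} have full rank p+1, with Moore–Penrose inverse M⁺ = Mᵀ(M Mᵀ)⁻¹. Let A ∈ ℝ^{p×q} be a submatrix of M (obtained by deleting one row and one column) such that det(A Aᵀ) is maximal among all p×q submatrices of M obtained by deleting one row and one column. Then det(M Mᵀ) · ‖M⁺‖_F² ≤ ((p+1)(q+1)/(q+1−p)) · det(A Aᵀ). -/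
open Matrix

/-- Deleting column `j` subtracts a rank-one matrix from the Gram matrix of the rows. -/
lemma gram_deleteCol {m : Type*} {q : ℕ} (B : Matrix m (Fin (q + 1)) ℝ) (j : Fin (q + 1)) :
    B.submatrix id j.succAbove * (B.submatrix id j.succAbove)ᵀ =
      B * Bᵀ + replicateCol Unit (-fun i => B i j) * replicateRow Unit (fun i => B i j) := by
  ext a b
  simp [Matrix.mul_apply, Fin.sum_univ_succAbove _ j]

lemma det_gram_nonneg {m n : Type*} [Fintype m] [DecidableEq m] [Fintype n] (B : Matrix m n ℝ) :
    0 ≤ (B * Bᵀ).det := by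
  simpa using (Matrix.posSemidef_self_mul_conjTranspose B).det_nonneg

/-- If every column-deleted Gram determinant is at most `c`, so is a multiple of the full one. -/
lemma mul_det_gram_le_of_deleteCol_le {m : Type*} [Fintype m] [DecidableEq m] {q : ℕ}
    (B : Matrix m (Fin (q + 1)) ℝ) (c : ℝ)
    (h : ∀ j : Fin (q + 1),
      (B.submatrix id j.succAbove * (B.submatrix id j.succAbove)ᵀ).det ≤ c) :
    ((q : ℝ) + 1 - Fintype.card m) * (B * Bᵀ).det ≤ ((q : ℝ) + 1) * c := by
  have hc : 0 ≤ c := (det_gram_nonneg _).trans (h 0)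
  by_cases hB : (B * Bᵀ).det = 0
  · rw [hB, mul_zero]
    positivity
  have hU : IsUnit (B * Bᵀ).det := isUnit_iff_ne_zero.mpr hB
  have hdet : ∀ j : Fin (q + 1),
      (B.submatrix id j.succAbove * (B.submatrix id j.succAbove)ᵀ).det =
        (B * Bᵀ).det * (1 - (Bᵀ * (B * Bᵀ)⁻¹ * B) j j) := by
    intro j
    rw [gram_deleteCol, det_add_replicateCol_mul_replicateRow hU]
    congr 1
    rw [det_unique]
    simp [Matrix.mul_apply, sub_eq_add_neg]
  have htr : ∑ j, (Bᵀ * (B * Bᵀ)⁻¹ * B) j j = Fintype.card m := by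
    change trace (Bᵀ * (B * Bᵀ)⁻¹ * B) = _
    rw [trace_mul_comm, ← Matrix.mul_assoc, mul_nonsing_inv _ hU, trace_one]
  calc ((q : ℝ) + 1 - Fintype.card m) * (B * Bᵀ).det
      = ∑ j : Fin (q + 1), (B.submatrix id j.succAbove * (B.submatrix id j.succAbove)ᵀ).det := by
        simp_rw [hdet]
        rw [← Finset.mul_sum, Finset.sum_sub_distrib, htr]
        simp [mul_comm]
    _ ≤ ∑ _j : Fin (q + 1), c := Finset.sum_le_sum fun j _ => h j
    _ = ((q : ℝ) + 1) * c := by simp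

/-- The squared Frobenius norm of the Moore–Penrose inverse in terms of row-deleted Gram
determinants. -/
lemma det_mul_frobenius_sq_pinv_eq {n : Type*} [Fintype n] {p : ℕ}
    (M : Matrix (Fin (p + 1)) n ℝ) (hM : IsUnit (M * Mᵀ).det) :
    (M * Mᵀ).det * (∑ i, ∑ j, ((Mᵀ * (M * Mᵀ)⁻¹) i j) ^ 2) =
      ∑ i : Fin (p + 1),
        (M.submatrix i.succAbove id * (M.submatrix i.succAbove id)ᵀ).det := by
  have hfrob : ∑ i, ∑ j, ((Mᵀ * (M * Mᵀ)⁻¹) i j) ^ 2 = trace (M * Mᵀ)⁻¹ := by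
    have hgram : (Mᵀ * (M * Mᵀ)⁻¹)ᵀ * (Mᵀ * (M * Mᵀ)⁻¹) = (M * Mᵀ)⁻¹ := by
      rw [transpose_mul, transpose_nonsing_inv, transpose_mul, transpose_transpose,
        Matrix.mul_assoc, ← Matrix.mul_assoc M, mul_nonsing_inv _ hM, Matrix.mul_one]
    rw [← congrArg trace hgram, Finset.sum_comm]
    simp only [trace, diag_apply, Matrix.mul_apply (M := (Mᵀ * (M * Mᵀ)⁻¹)ᵀ), transpose_apply, sq]
  have hadj : (M * Mᵀ).det • (M * Mᵀ)⁻¹ = adjugate (M * Mᵀ) := by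
    rw [inv_def, smul_smul, Ring.mul_inverse_cancel _ hM, one_smul]
  rw [hfrob, ← smul_eq_mul, ← trace_smul, hadj, trace]
  refine Finset.sum_congr rfl fun i _ => ?_
  rw [diag_apply, adjugate_fin_succ_eq_det_submatrix, Even.neg_one_pow ⟨_, rfl⟩, one_mul]
  rfl

/-- Let `p ≤ q` and let `M ∈ ℝ^{(p+1)×(q+1)}` have full rank `p+1`, with
Moore–Penrose inverse `M⁺ = Mᵀ (M Mᵀ)⁻¹`. Let `A = M.submatrix i₀.succAbove j₀.succAbove`
(delete one row and one column of `M`) be such that `det (A Aᵀ)` is maximal among all such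
row/column-deleted submatrices. Then
`det (M Mᵀ) · ‖M⁺‖_F² ≤ ((p+1)(q+1)/(q+1−p)) · det (A Aᵀ)`. -/
theorem det_mul_frobenius_sq_pinv_le_of_maximal_submatrix
    (p q : ℕ) (hpq : p ≤ q) (M : Matrix (Fin (p + 1)) (Fin (q + 1)) ℝ)
    (hrank : M.rank = p + 1) (i₀ : Fin (p + 1)) (j₀ : Fin (q + 1))
    (hmax : ∀ (i : Fin (p + 1)) (j : Fin (q + 1)),
      ((M.submatrix i.succAbove j.succAbove) * (M.submatrix i.succAbove j.succAbove)ᵀ).det ≤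
        ((M.submatrix i₀.succAbove j₀.succAbove) *
          (M.submatrix i₀.succAbove j₀.succAbove)ᵀ).det) :
    (M * Mᵀ).det * (∑ i, ∑ j, ((Mᵀ * (M * Mᵀ)⁻¹) i j) ^ 2) ≤
      (((p : ℝ) + 1) * ((q : ℝ) + 1) / ((q : ℝ) + 1 - p)) *
        ((M.submatrix i₀.succAbove j₀.succAbove) *
          (M.submatrix i₀.succAbove j₀.succAbove)ᵀ).det := by
  set c := ((M.submatrix i₀.succAbove j₀.succAbove) *
    (M.submatrix i₀.succAbove j₀.succAbove)ᵀ).det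
  have hpq' : (0 : ℝ) < (q : ℝ) + 1 - p := by
    have : (p : ℝ) ≤ q := by exact_mod_cast hpq
    linarith
  have hc : 0 ≤ c := det_gram_nonneg _
  by_cases hM : (M * Mᵀ).det = 0
  · rw [hM, zero_mul]
    positivity
  rw [det_mul_frobenius_sq_pinv_eq M (isUnit_iff_ne_zero.mpr hM)]
  calc _ ≤ ∑ _i : Fin (p + 1), ((q : ℝ) + 1) * c / ((q : ℝ) + 1 - p) := by
        refine Finset.sum_le_sum fun i _ => ?_
        rw [le_div_iff₀ hpq', mul_comm]
        simpa using mul_det_gram_le_of_deleteCol_le (M.submatrix i.succAbove id) c (hmax i)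
    _ = _ := by
        simp only [Finset.sum_const, Finset.card_univ, Fintype.card_fin, nsmul_eq_mul]
        push_cast
        ring
end

section
/- Let p ≤ q, let A ∈ ℝ^{p×q} have full row rank p with Moore–Penrose inverse A⁺ = Aᵀ(A Aᵀ)⁻¹, let b ∈ ℝ^p, c ∈ ℝ^q, d ∈ ℝ, and let M = [[A, b],[cᵀ, d]] ∈ ℝ^{(p+1)×(q+1)}. Set u = (I − A⁺A)c and γ = d − cᵀA⁺b. Then det(M Mᵀ) ≥ (‖u‖₂² + γ²) · det(A Aᵀ). -/
open Matrix

namespace Matrix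

variable {m n : Type*} [Fintype m] [DecidableEq m] [Fintype n]

theorem posDef_self_mul_transpose_of_rank_eq_card {A : Matrix m n ℝ}
    (hA : A.rank = Fintype.card m) : (A * Aᵀ).PosDef := by
  have hpsd : (A * Aᵀ).PosSemidef := by
    simpa using posSemidef_self_mul_conjTranspose A
  refine hpsd.posDef_iff_isUnit.mpr (mulVec_surjective_iff_isUnit.mp ?_)
  change Function.Surjective (A * Aᵀ).mulVecLin
  rw [← LinearMap.range_eq_top]
  apply Submodule.eq_top_of_finrank_eq
  rw [Module.finrank_fintype_fun_eq_card, ← hA, ← rank_self_mul_transpose, rank]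

theorem det_le_det_add_mul_transpose {G : Matrix m m ℝ} (hG : G.PosDef)
    (B : Matrix m (Fin 1) ℝ) : G.det ≤ (G + B * Bᵀ).det := by
  rw [det_add_mul B Bᵀ hG.det_pos.ne'.isUnit, det_fin_one, add_apply, one_apply_eq]
  have h : (Bᵀ * G⁻¹ * B).PosSemidef := by
    simpa using hG.inv.posSemidef.conjTranspose_mul_mul_same B
  exact le_mul_of_one_le_right hG.det_pos.le (le_add_of_nonneg_right h.diag_nonneg)

theorem det_fromBlocks_mul_transpose_of_mul_transpose_eq_zero {A : Matrix m n ℝ}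
    (B : Matrix m (Fin 1) ℝ) {U : Matrix (Fin 1) n ℝ} (Γ : Matrix (Fin 1) (Fin 1) ℝ)
    (hAU : A * Uᵀ = 0) (hH : (A * Aᵀ + B * Bᵀ).det ≠ 0) :
    (fromBlocks A B U Γ * (fromBlocks A B U Γ)ᵀ).det =
      (U * Uᵀ) 0 0 * (A * Aᵀ + B * Bᵀ).det + Γ 0 0 ^ 2 * (A * Aᵀ).det := by
  have hUA : U * Aᵀ = 0 := by simpa using congrArg transpose hAU
  rw [fromBlocks_transpose, fromBlocks_multiply, hAU, hUA, zero_add, zero_add]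
  set H := A * Aᵀ + B * Bᵀ with hHdef
  let _ := invertibleOfIsUnitDet H hH.isUnit
  have hG : (A * Aᵀ).det = H.det * (1 - (Bᵀ * H⁻¹ * B) 0 0) := by
    have h := det_add_mul (-B) Bᵀ hH.isUnit
    rw [det_fin_one, Matrix.neg_mul, Matrix.mul_neg, add_apply, one_apply_eq, neg_apply] at h
    rw [sub_eq_add_neg, ← h, hHdef, add_neg_cancel_right]
  have hS : Γ * Bᵀ * ⅟H * (B * Γᵀ) = Γ * (Bᵀ * H⁻¹ * B) * Γᵀ := by
    simp only [invOf_eq_nonsing_inv, Matrix.mul_assoc]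
  rw [det_fromBlocks₁₁, hS, hG, det_fin_one]
  generalize Bᵀ * H⁻¹ * B = K
  simp only [sub_apply, add_apply, mul_apply (M := Γ), mul_apply (M := Γ * K),
    Fin.sum_univ_one, transpose_apply]
  ring

theorem det_fromBlocks_sub_mul_mul_transpose (A : Matrix m n ℝ) (B : Matrix m (Fin 1) ℝ)
    (C : Matrix (Fin 1) n ℝ) (D : Matrix (Fin 1) (Fin 1) ℝ) (Y : Matrix (Fin 1) m ℝ) :
    (fromBlocks A B (C - Y * A) (D - Y * B) *
      (fromBlocks A B (C - Y * A) (D - Y * B))ᵀ).det =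
      (fromBlocks A B C D * (fromBlocks A B C D)ᵀ).det := by
  let L : Matrix (m ⊕ Fin 1) (m ⊕ Fin 1) ℝ := fromBlocks 1 0 (-Y) 1
  have h : fromBlocks A B (C - Y * A) (D - Y * B) = L * fromBlocks A B C D := by
    simp [L, fromBlocks_multiply, sub_eq_neg_add]
  have hL : L.det = 1 := by simp [L]
  rw [h, transpose_mul, ← Matrix.mul_assoc, Matrix.mul_assoc L, det_mul, det_mul,
    det_transpose, hL, one_mul, mul_one]

end Matrix

/-- Let `p ≤ q`, let `A ∈ ℝ^{p×q}` have full row rank `p` with Moore–Penrose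
inverse `A⁺ = Aᵀ (A Aᵀ)⁻¹`, let `b ∈ ℝ^p`, `c ∈ ℝ^q`, `d ∈ ℝ`, and let
`M = [[A, b],[cᵀ, d]] ∈ ℝ^{(p+1)×(q+1)}`. Set `u = (I − A⁺A) c` and `γ = d − cᵀ A⁺ b`.
Then `det (M Mᵀ) ≥ (‖u‖₂² + γ²) · det (A Aᵀ)`. -/
theorem det_block_ge_norm_sq_add_gamma_sq_mul_det
    (p q : ℕ) (hp : 0 < p) (hpq : p ≤ q)
    (A : Matrix (Fin p) (Fin q) ℝ) (hA : A.rank = p)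
    (b : Fin p → ℝ) (c : Fin q → ℝ) (d : ℝ)
    (M : Matrix (Fin p ⊕ Fin 1) (Fin q ⊕ Fin 1) ℝ)
    (hM : M = Matrix.fromBlocks A (Matrix.of fun i (_ : Fin 1) => b i)
      (Matrix.of fun (_ : Fin 1) j => c j) (Matrix.of fun (_ : Fin 1) (_ : Fin 1) => d))
    (u : Fin q → ℝ) (hu : u = (1 - (Aᵀ * (A * Aᵀ)⁻¹) * A) *ᵥ c)
    (γ : ℝ) (hγ : γ = d - c ⬝ᵥ ((Aᵀ * (A * Aᵀ)⁻¹) *ᵥ b)) :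
    ((∑ i, u i ^ 2) + γ ^ 2) * (A * Aᵀ).det ≤ (M * Mᵀ).det := by
  have hG : (A * Aᵀ).PosDef := posDef_self_mul_transpose_of_rank_eq_card (by simpa using hA)
  have hGu : IsUnit (A * Aᵀ).det := hG.det_pos.ne'.isUnit
  have hGs : ((A * Aᵀ)⁻¹)ᵀ = (A * Aᵀ)⁻¹ := by
    rw [transpose_nonsing_inv, transpose_mul, transpose_transpose]
  set B : Matrix (Fin p) (Fin 1) ℝ := Matrix.of fun i _ => b i with hB
  set C : Matrix (Fin 1) (Fin q) ℝ := Matrix.of fun _ j => c j with hC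
  set D : Matrix (Fin 1) (Fin 1) ℝ := Matrix.of fun _ _ => d with hD
  set Y : Matrix (Fin 1) (Fin p) ℝ := C * (Aᵀ * (A * Aᵀ)⁻¹) with hY
  have hU : (C - Y * A)ᵀ = (1 - (Aᵀ * (A * Aᵀ)⁻¹) * A) * Cᵀ := by
    simp only [hY, transpose_sub, transpose_mul, transpose_transpose, hGs, Matrix.sub_mul,
      Matrix.one_mul, Matrix.mul_assoc]
  have hAU : A * (C - Y * A)ᵀ = 0 := by
    rw [hU, ← Matrix.mul_assoc, Matrix.mul_sub, Matrix.mul_one, ← Matrix.mul_assoc,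
      ← Matrix.mul_assoc, mul_nonsing_inv _ hGu, Matrix.one_mul, sub_self, Matrix.zero_mul]
  have hu' (i : Fin q) : (C - Y * A)ᵀ i 0 = u i := by
    rw [hU, hu]
    rfl
  have hnorm : ((C - Y * A) * (C - Y * A)ᵀ) 0 0 = ∑ i, u i ^ 2 := by
    rw [mul_apply]
    refine Finset.sum_congr rfl fun i _ => ?_
    rw [← transpose_apply (C - Y * A), hu', sq]
  have hγ' : (D - Y * B) 0 0 = γ := by
    rw [hY, Matrix.mul_assoc, hγ]
    rfl
  have hle := det_le_det_add_mul_transpose hG B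
  rw [hM, ← det_fromBlocks_sub_mul_mul_transpose A B C D Y,
    det_fromBlocks_mul_transpose_of_mul_transpose_eq_zero B _ hAU (hG.det_pos.trans_le hle).ne',
    hnorm, hγ', add_mul]
  gcongr
end

section
/- Let p ≤ q and let M ∈ ℝ^{(p+1)×(q+1)} have full rank p+1, with singular values σ₁ ≥ σ₂ ≥ ... ≥ σ_{p+1} > 0 in decreasing order. Write M = [[A, b],[cᵀ, d]] with A ∈ ℝ^{p×q} of rank p, and suppose det(A Aᵀ) is maximal among all p×q submatrices of M obtained by deleting one row and one column. Let M̂ = [A; cᵀ] · A⁺ · [A, b] where A⁺ = Aᵀ(A Aᵀ)⁻¹. Then ‖M̂ − M‖_C² ≤ ((p+1)(q+1)/(q+1−p)) / (σ₁⁻² + σ₂⁻² + ... + σ_{p+1}⁻²). -/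
open Matrix

/-- Summed over all ways of deleting one column, the Gram determinants of `N` add up to
`(number of columns - number of rows)` times the Gram determinant of `N`. -/
theorem sum_det_gram_submatrix_succAbove {m : Type*} [Fintype m] [DecidableEq m] {q : ℕ}
    (N : Matrix m (Fin (q + 1)) ℝ) (hN : IsUnit (N * Nᵀ).det) :
    ∑ j : Fin (q + 1), (N.submatrix id j.succAbove * (N.submatrix id j.succAbove)ᵀ).det =
      ((q : ℝ) + 1 - Fintype.card m) * (N * Nᵀ).det := by
  have det_delete (j : Fin (q + 1)) :
      (N.submatrix id j.succAbove * (N.submatrix id j.succAbove)ᵀ).det =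
        (N * Nᵀ).det * (1 - (Nᵀ * (N * Nᵀ)⁻¹ * N) j j) := by
    have gram_delete : N.submatrix id j.succAbove * (N.submatrix id j.succAbove)ᵀ =
        N * Nᵀ + (-N.submatrix id (fun _ : Unit => j)) * Nᵀ.submatrix (fun _ : Unit => j) id := by
      ext a b
      simp [mul_apply, Fin.sum_univ_succAbove _ j]
    rw [gram_delete, det_add_mul _ _ hN, det_unique (n := Unit)]
    congr 1
    simp [mul_apply, sub_eq_add_neg]
  have trace_proj : ∑ j, (Nᵀ * (N * Nᵀ)⁻¹ * N) j j = Fintype.card m := by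
    change trace (Nᵀ * (N * Nᵀ)⁻¹ * N) = _
    rw [Matrix.trace_mul_comm, ← Matrix.mul_assoc, mul_nonsing_inv _ hN, trace_one]
  simp_rw [det_delete]
  rw [← Finset.mul_sum, Finset.sum_sub_distrib, trace_proj]
  simp [mul_comm]

/-- The Gram determinant of a block matrix whose last row is `[r, s]` with `r` orthogonal to the
rows of `A`. -/
theorem det_gram_fromBlocks_of_orthogonal {m n : Type*} [Fintype m] [DecidableEq m] [Fintype n]
    (A : Matrix m n ℝ) (b : Matrix m (Fin 1) ℝ) (r : Matrix (Fin 1) n ℝ)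
    (s : Matrix (Fin 1) (Fin 1) ℝ) (hA : (A * Aᵀ).PosDef) (hr : A * rᵀ = 0) :
    (fromBlocks A b r s * (fromBlocks A b r s)ᵀ).det =
      (A * Aᵀ).det * ((1 + (bᵀ * (A * Aᵀ)⁻¹ * b) 0 0) * (r * rᵀ) 0 0 + s 0 0 ^ 2) := by
  have hr' : r * Aᵀ = 0 := by
    rw [← transpose_transpose r, ← transpose_mul, hr, transpose_zero]
  have hdet := hA.det_pos
  set S := A * Aᵀ with hS
  set β := (bᵀ * S⁻¹ * b) 0 0 with hβ
  have hβ0 : 0 ≤ β := by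
    have := (hA.inv.posSemidef.conjTranspose_mul_mul_same b).diag_nonneg (i := 0)
    simpa [conjTranspose_eq_transpose_of_trivial] using this
  have hscalar : bᵀ * S⁻¹ * b = β • (1 : Matrix (Fin 1) (Fin 1) ℝ) := by
    ext i j
    fin_cases i; fin_cases j; simp [hβ]
  have hunit : IsUnit S.det := hdet.ne'.isUnit
  have hdetB : (S + b * bᵀ).det = S.det * (1 + β) := by
    rw [det_add_mul _ _ hunit, hscalar, det_unique (n := Fin 1)]
    simp
  have hunitB : IsUnit (S + b * bᵀ).det := by
    rw [hdetB]; exact (by positivity : S.det * (1 + β) ≠ 0).isUnit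
  let := invertibleOfIsUnitDet _ hunitB
  have hsolve : ⅟(S + b * bᵀ) * b = (1 + β)⁻¹ • (S⁻¹ * b) := by
    have hmul : (S + b * bᵀ) * (S⁻¹ * b) = (1 + β) • b := by
      rw [Matrix.add_mul, mul_nonsing_inv_cancel_left _ _ hunit, Matrix.mul_assoc,
        ← Matrix.mul_assoc bᵀ, hscalar, Matrix.mul_smul, Matrix.mul_one, add_smul, one_smul]
    rw [eq_inv_smul_iff₀ (by positivity), ← Matrix.mul_smul, ← hmul, ← Matrix.mul_assoc,
      invOf_mul_self, Matrix.one_mul]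
  rw [fromBlocks_transpose, fromBlocks_multiply, hr, hr', ← hS, zero_add, zero_add,
    det_fromBlocks₁₁, hdetB, det_unique (n := Fin 1)]
  have hschur : s * bᵀ * ⅟(S + b * bᵀ) * (b * sᵀ) = (s 0 0 ^ 2 * (β / (1 + β))) • 1 := by
    have : s * bᵀ * ⅟(S + b * bᵀ) * (b * sᵀ) = s * (bᵀ * (⅟(S + b * bᵀ) * b)) * sᵀ := by
      simp only [Matrix.mul_assoc]
    rw [this, hsolve, Matrix.mul_smul, ← Matrix.mul_assoc bᵀ, hscalar]
    ext i j
    fin_cases i; fin_cases j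
    simp [mul_apply]
    ring
  rw [hschur]
  have : (1 + β) ≠ 0 := by positivity
  simp [mul_apply]
  field_simp
  ring

/-- Every entry of the error of the pseudo-skeleton approximation of `[[A, b], [c, d]]` is bounded
by the ratio of the Gram determinants. -/
theorem pseudo_skeleton_error_sq_mul_det_le {m n : Type*} [Fintype m] [DecidableEq m] [Fintype n]
    (A : Matrix m n ℝ) (b : Matrix m (Fin 1) ℝ) (c : Matrix (Fin 1) n ℝ)
    (d : Matrix (Fin 1) (Fin 1) ℝ) (hA : (A * Aᵀ).PosDef) (i : m ⊕ Fin 1) (j : n ⊕ Fin 1) :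
    (fromRows A c * (Aᵀ * (A * Aᵀ)⁻¹) * fromCols A b - fromBlocks A b c d) i j ^ 2 *
        (A * Aᵀ).det ≤ (fromBlocks A b c d * (fromBlocks A b c d)ᵀ).det := by
  have hunit : IsUnit (A * Aᵀ).det := hA.det_pos.ne'.isUnit
  obtain ⟨y, hy⟩ : ∃ y, y = c * (Aᵀ * (A * Aᵀ)⁻¹) := ⟨_, rfl⟩
  have herr : fromRows A c * (Aᵀ * (A * Aᵀ)⁻¹) * fromCols A b - fromBlocks A b c d =
      fromBlocks 0 0 (y * A - c) (y * b - d) := by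
    rw [fromRows_mul, ← Matrix.mul_assoc A, mul_nonsing_inv _ hunit, ← hy,
      fromRows_mul_fromCols, Matrix.one_mul, Matrix.one_mul, sub_eq_add_neg, fromBlocks_neg,
      fromBlocks_add]
    simp [sub_eq_add_neg]
  have hfac : fromBlocks A b c d =
      (fromBlocks 1 0 y (-1) : Matrix (m ⊕ Fin 1) (m ⊕ Fin 1) ℝ) *
        fromBlocks A b (y * A - c) (y * b - d) := by
    rw [fromBlocks_multiply]
    simp
  have horth : A * (y * A - c)ᵀ = 0 := by
    have : (y * A - c) * Aᵀ = 0 := by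
      rw [hy, Matrix.sub_mul, Matrix.mul_assoc _ A, ← Matrix.mul_assoc c,
        nonsing_inv_mul_cancel_right _ _ hunit, sub_self]
    rw [← transpose_transpose A, ← transpose_mul, transpose_transpose, this, transpose_zero]
  have hdet : (fromBlocks A b c d * (fromBlocks A b c d)ᵀ).det =
      (fromBlocks A b (y * A - c) (y * b - d) *
        (fromBlocks A b (y * A - c) (y * b - d))ᵀ).det := by
    rw [hfac, transpose_mul, Matrix.mul_assoc, det_mul, ← Matrix.mul_assoc, det_mul,
      det_transpose, det_fromBlocks_zero₁₂]
    simp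
  rw [herr, hdet, det_gram_fromBlocks_of_orthogonal _ _ _ _ hA horth, mul_comm]
  refine mul_le_mul_of_nonneg_left ?_ hA.det_pos.le
  have hβ0 : 0 ≤ (bᵀ * (A * Aᵀ)⁻¹ * b) 0 0 := by
    have := (hA.inv.posSemidef.conjTranspose_mul_mul_same b).diag_nonneg (i := 0)
    simpa [conjTranspose_eq_transpose_of_trivial] using this
  set r := y * A - c
  have hrr : (r * rᵀ) 0 0 = ∑ k, r 0 k ^ 2 := by simp [mul_apply, sq]
  have hnonneg : 0 ≤ (r * rᵀ) 0 0 := by rw [hrr]; positivity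
  rcases i with i | i
  · rcases j with j | j <;> simp <;> positivity
  · fin_cases i
    rcases j with j | j
    · have : r 0 j ^ 2 ≤ (r * rᵀ) 0 0 := by
        rw [hrr]
        exact Finset.single_le_sum (f := fun k => r 0 k ^ 2) (fun _ _ => sq_nonneg _)
          (Finset.mem_univ j)
      simp only [Fin.zero_eta, fromBlocks_apply₂₁]
      nlinarith [mul_nonneg hβ0 hnonneg, sq_nonneg ((y * b - d) 0 0)]
    · fin_cases j
      simp only [Fin.zero_eta, fromBlocks_apply₂₂]
      nlinarith [mul_nonneg hβ0 hnonneg]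

/-- Let `p ≤ q` and let `M ∈ ℝ^{(p+1)×(q+1)}` have full rank `p+1`, with
singular values `σ₁ ≥ ... ≥ σ_{p+1} > 0` (encoded by an orthogonal diagonalisation of
`M Mᵀ` with antitone positive `σ`). Write `M = [[A, b],[cᵀ, d]]` with
`A = M.submatrix castSucc castSucc` of rank `p`, and suppose `det (A Aᵀ)` is maximal among
all `p×q` submatrices of `M` obtained by deleting one row and one column. Let
`M̂ = [A; cᵀ] A⁺ [A, b]` with `A⁺ = Aᵀ (A Aᵀ)⁻¹`. Then
`‖M̂ − M‖_C² ≤ ((p+1)(q+1)/(q+1−p)) / (σ₁⁻² + ... + σ_{p+1}⁻²)`. -/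
theorem maxvol_pseudo_skeleton_error_sq_le_block_case
    (p q : ℕ) (hpq : p ≤ q) (M : Matrix (Fin (p + 1)) (Fin (q + 1)) ℝ)
    (hrank : M.rank = p + 1)
    (σ : Fin (p + 1) → ℝ) (hanti : Antitone σ) (hσpos : ∀ k, 0 < σ k)
    (U : Matrix (Fin (p + 1)) (Fin (p + 1)) ℝ) (hU : U * Uᵀ = 1)
    (hdiag : M * Mᵀ = U * Matrix.diagonal (fun k => σ k ^ 2) * Uᵀ)
    (A : Matrix (Fin p) (Fin q) ℝ) (hA : A = M.submatrix Fin.castSucc Fin.castSucc)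
    (hArank : A.rank = p)
    (hmax : ∀ (i : Fin (p + 1)) (j : Fin (q + 1)),
      ((M.submatrix i.succAbove j.succAbove) * (M.submatrix i.succAbove j.succAbove)ᵀ).det ≤
        (A * Aᵀ).det)
    (Mhat : Matrix (Fin (p + 1)) (Fin (q + 1)) ℝ)
    (hMhat : Mhat =
      M.submatrix id Fin.castSucc * (Aᵀ * (A * Aᵀ)⁻¹) * M.submatrix Fin.castSucc id) :
    ∀ i j, |(Mhat - M) i j| ^ 2 ≤
      (((p : ℝ) + 1) * ((q : ℝ) + 1) / ((q : ℝ) + 1 - p)) / (∑ k, (σ k ^ 2)⁻¹) := by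
  have hUt : Uᵀ * U = 1 := mul_eq_one_comm.mp hU
  have hdetG : (M * Mᵀ).det = ∏ k, σ k ^ 2 := by
    rw [hdiag, det_mul_right_comm, hU, Matrix.one_mul, det_diagonal]
  have hdetG_pos : 0 < (M * Mᵀ).det := by
    rw [hdetG]; exact Finset.prod_pos fun k _ => pow_pos (hσpos k) 2
  have hG : (M * Mᵀ).PosDef := by
    have hsemi : (M * Mᵀ).PosSemidef := by
      simpa [conjTranspose_eq_transpose_of_trivial] using posSemidef_self_mul_conjTranspose M
    exact hsemi.posDef_iff_isUnit.mpr ((isUnit_iff_isUnit_det _).mpr hdetG_pos.ne'.isUnit)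
  have hinv : (M * Mᵀ)⁻¹ = U * diagonal (fun k => (σ k ^ 2)⁻¹) * Uᵀ := by
    refine inv_eq_right_inv ?_
    have hDD : diagonal (fun k => σ k ^ 2) * diagonal (fun k => (σ k ^ 2)⁻¹) = 1 := by
      rw [diagonal_mul_diagonal, ← diagonal_one]
      congr 1
      ext k
      exact mul_inv_cancel₀ (pow_pos (hσpos k) 2).ne'
    calc _ = U * diagonal (fun k => σ k ^ 2) * (Uᵀ * U) * diagonal (fun k => (σ k ^ 2)⁻¹) * Uᵀ := by
          rw [hdiag]; simp only [Matrix.mul_assoc]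
      _ = U * (diagonal (fun k => σ k ^ 2) * diagonal (fun k => (σ k ^ 2)⁻¹)) * Uᵀ := by
          rw [hUt]; simp only [Matrix.mul_assoc, Matrix.one_mul]
      _ = 1 := by rw [hDD, Matrix.mul_one, hU]
  have htrace : trace (M * Mᵀ)⁻¹ = ∑ k, (σ k ^ 2)⁻¹ := by
    rw [hinv, trace_mul_comm, ← Matrix.mul_assoc, hUt, Matrix.one_mul, trace_diagonal]
  have hminors : (∑ k, (σ k ^ 2)⁻¹) * (M * Mᵀ).det =
      ∑ i : Fin (p + 1), ((M * Mᵀ).submatrix i.succAbove i.succAbove).det := by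
    rw [← htrace, inv_def, trace_smul, Ring.inverse_eq_inv', smul_eq_mul, mul_right_comm,
      inv_mul_cancel₀ hdetG_pos.ne', one_mul, trace]
    refine Finset.sum_congr rfl fun i _ => ?_
    rw [diag_apply, adjugate_fin_succ_eq_det_submatrix, Even.neg_one_pow ⟨_, rfl⟩, one_mul]
  have hrow (i : Fin (p + 1)) :
      ((q : ℝ) + 1 - p) * ((M * Mᵀ).submatrix i.succAbove i.succAbove).det ≤
        ((q : ℝ) + 1) * (A * Aᵀ).det := by
    have hpos := (hG.submatrix (Fin.succAbove_right_injective (p := i))).det_pos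
    have hgram : (M * Mᵀ).submatrix i.succAbove i.succAbove =
        M.submatrix i.succAbove id * (M.submatrix i.succAbove id)ᵀ := rfl
    rw [hgram] at hpos ⊢
    have hsum := sum_det_gram_submatrix_succAbove _ hpos.ne'.isUnit
    rw [Fintype.card_fin] at hsum
    rw [← hsum]
    calc _ ≤ ∑ _j : Fin (q + 1), (A * Aᵀ).det := Finset.sum_le_sum fun j _ => hmax i j
      _ = _ := by simp
  have hpq' : (0 : ℝ) < (q : ℝ) + 1 - p := by
    have : (p : ℝ) ≤ q := Nat.cast_le.mpr hpq
    linarith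
  have hσsum : 0 < ∑ k, (σ k ^ 2)⁻¹ :=
    Finset.sum_pos (fun k _ => inv_pos.mpr (pow_pos (hσpos k) 2)) Finset.univ_nonempty
  have hvol : ((q : ℝ) + 1 - p) * ((∑ k, (σ k ^ 2)⁻¹) * (M * Mᵀ).det) ≤
      ((p : ℝ) + 1) * ((q : ℝ) + 1) * (A * Aᵀ).det := by
    rw [hminors, Finset.mul_sum]
    calc _ ≤ ∑ _i : Fin (p + 1), ((q : ℝ) + 1) * (A * Aᵀ).det :=
          Finset.sum_le_sum fun i _ => hrow i
      _ = _ := by simp [mul_assoc]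
  have hdetA : 0 < (A * Aᵀ).det :=
    pos_of_mul_pos_right (lt_of_lt_of_le (by positivity) hvol) (by positivity)
  have hApos : (A * Aᵀ).PosDef := by
    have hsemi : (A * Aᵀ).PosSemidef := by
      simpa [conjTranspose_eq_transpose_of_trivial] using posSemidef_self_mul_conjTranspose A
    exact hsemi.posDef_iff_isUnit.mpr ((isUnit_iff_isUnit_det _).mpr hdetA.ne'.isUnit)
  intro i j
  have herr : (Mhat - M) i j ^ 2 * (A * Aᵀ).det ≤ (M * Mᵀ).det := by
    let er : Fin p ⊕ Fin 1 ≃ Fin (p + 1) := finSumFinEquiv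
    let ec : Fin q ⊕ Fin 1 ≃ Fin (q + 1) := finSumFinEquiv
    let N := M.submatrix er ec
    have hA' : N.toBlocks₁₁ = A := hA.symm
    have hN : fromBlocks A N.toBlocks₁₂ N.toBlocks₂₁ N.toBlocks₂₂ = N := by
      rw [← hA', fromBlocks_toBlocks]
    have hrows : M.submatrix er Fin.castSucc = fromRows A N.toBlocks₂₁ := by
      rw [hA]; ext (a | a) k <;> rfl
    have hcols : M.submatrix Fin.castSucc ec = fromCols A N.toBlocks₁₂ := by
      rw [hA]; ext a (k | k) <;> rfl
    have key := pseudo_skeleton_error_sq_mul_det_le A N.toBlocks₁₂ N.toBlocks₂₁ N.toBlocks₂₂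
      hApos (er.symm i) (ec.symm j)
    have hdetN : (N * Nᵀ).det = (M * Mᵀ).det := by
      rw [transpose_submatrix, submatrix_mul_equiv, det_submatrix_equiv_self]
    have hentry : (fromRows A N.toBlocks₂₁ * (Aᵀ * (A * Aᵀ)⁻¹) * fromCols A N.toBlocks₁₂ - N)
        (er.symm i) (ec.symm j) = (Mhat - M) i j := by
      have hsub : fromRows A N.toBlocks₂₁ * (Aᵀ * (A * Aᵀ)⁻¹) * fromCols A N.toBlocks₁₂ - N =
          (Mhat - M).submatrix er ec := by
        rw [← hrows, ← hcols, hMhat]; rfl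
      rw [hsub]; simp
    rwa [hN, hdetN, hentry] at key
  rw [sq_abs, le_div_iff₀ hσsum, le_div_iff₀ hpq']
  refine le_of_mul_le_mul_right ?_ hdetA
  calc _ = ((q : ℝ) + 1 - p) * ((∑ k, (σ k ^ 2)⁻¹) * ((Mhat - M) i j ^ 2 * (A * Aᵀ).det)) := by
        ring
    _ ≤ ((q : ℝ) + 1 - p) * ((∑ k, (σ k ^ 2)⁻¹) * (M * Mᵀ).det) := by gcongr
    _ ≤ _ := hvol
end

section
/- Let M ∈ ℝ^{m×n} with rank(M) ≥ r+1 and singular values σ₁ ≥ σ₂ ≥ ... in decreasing order, and suppose there exist constants C₁, C₂ > 0 and s > 0 with C₁·k^{−2s} ≤ σ_k² ≤ C₂·k^{−2s} for all k. Let q = α·r − 1 for some rational α > 1, write M = [[A, B],[C, D]] with A ∈ ℝ^{r×q} of rank r and det(A Aᵀ) maximal among all r×q submatrices of M, and let M̂ = [A; C]·A⁺·[A, B] with A⁺ = Aᵀ(A Aᵀ)⁻¹. Then ‖M̂ − M‖_C² ≤ (α/(α−1)) · (C₂/C₁) · (2s+1) · σ_{r+1}(M)². -/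
open Matrix

theorem exists_antitone_orthogonal_diagonalization {N : ℕ} {P : Matrix (Fin N) (Fin N) ℝ}
    (hP : P.PosDef) :
    ∃ (Q : Matrix (Fin N) (Fin N) ℝ) (p : Fin N → ℝ), Antitone p ∧ (∀ k, 0 < p k) ∧
      Qᵀ * Q = 1 ∧ P = Q * diagonal p * Qᵀ := by
  set V : Matrix (Fin N) (Fin N) ℝ := hP.isHermitian.eigenvectorUnitary.1 with hV
  set e := hP.isHermitian.eigenvalues with he
  have h1 : Vᵀ * V = 1 := by
    have := (Matrix.mem_unitaryGroup_iff').1 hP.isHermitian.eigenvectorUnitary.2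
    simpa [star_eq_conjTranspose] using this
  have h2 : P = V * diagonal e * Vᵀ := by
    have := hP.isHermitian.spectral_theorem
    simpa [Unitary.conjStarAlgAut_apply, star_eq_conjTranspose, Function.comp_def] using this
  let τ := Tuple.sort (-e)
  refine ⟨V.submatrix id τ, e ∘ τ, ?_, fun k => hP.eigenvalues_pos _, ?_, ?_⟩
  · intro a b hab
    have := Tuple.monotone_sort (-e) hab
    simpa using this
  · rw [transpose_submatrix, submatrix_mul _ _ τ id τ Function.bijective_id |>.symm, h1]
    simp
  · rw [h2, transpose_submatrix, ← submatrix_diagonal_equiv, submatrix_mul_equiv,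
      submatrix_mul_equiv]
    simp

theorem trace_inv_eq_sum {N : ℕ} {Q : Matrix (Fin N) (Fin N) ℝ} {p : Fin N → ℝ}
    (hp : ∀ k, 0 < p k) (hQ : Qᵀ * Q = 1) :
    (Q * diagonal p * Qᵀ)⁻¹.trace = ∑ k, (p k)⁻¹ := by
  have hQ' : Q * Qᵀ = 1 := mul_eq_one_comm.1 hQ
  have : (Q * diagonal p * Qᵀ)⁻¹ = Q * diagonal (fun k => (p k)⁻¹) * Qᵀ := by
    apply inv_eq_right_inv
    calc Q * diagonal p * Qᵀ * (Q * diagonal (fun k => (p k)⁻¹) * Qᵀ)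
        = Q * diagonal p * (Qᵀ * Q) * diagonal (fun k => (p k)⁻¹) * Qᵀ := by
          simp only [Matrix.mul_assoc]
      _ = 1 := by
          rw [hQ, Matrix.mul_one, Matrix.mul_assoc Q, diagonal_mul_diagonal]
          simp [fun k => mul_inv_cancel₀ (hp k).ne', hQ']
  rw [this, trace_mul_comm, ← Matrix.mul_assoc, hQ, Matrix.one_mul, trace_diagonal]

theorem mul_sum_inv_trace {r : ℕ} {κ : Type*} [Fintype κ] (X : Matrix (Fin (r + 1)) κ ℝ)
    (h : (X * Xᵀ).det ≠ 0) :
    (X * Xᵀ).det * (X * Xᵀ)⁻¹.trace =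
      ∑ i : Fin (r + 1), (X.submatrix i.succAbove id * (X.submatrix i.succAbove id)ᵀ).det := by
  rw [inv_def, trace_smul, Ring.inverse_eq_inv', smul_eq_mul, mul_inv_cancel_left₀ h, trace]
  refine Finset.sum_congr rfl fun i _ => ?_
  rw [diag_apply, adjugate_fin_succ_eq_det_submatrix, Even.neg_one_pow ⟨_, rfl⟩, one_mul]
  congr 1

theorem rpow_div_le_sum_rpow {p : ℝ} (hp : 0 < p) (N : ℕ) :
    (N : ℝ) ^ (p + 1) / (p + 1) ≤ ∑ k ∈ Finset.range N, ((k : ℝ) + 1) ^ p := by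
  induction N with
  | zero => simp [Real.zero_rpow (by positivity : p + 1 ≠ 0)]
  | succ N ih =>
    rw [Finset.sum_range_succ]
    refine le_trans ?_ (add_le_add_left ih _)
    have hN : (0 : ℝ) < N + 1 := by positivity
    have hb : 1 + (p + 1) * (-1 / ((N : ℝ) + 1)) ≤ (1 + (-1 / ((N : ℝ) + 1))) ^ (p + 1) :=
      one_add_mul_self_le_rpow_one_add
        (by rw [le_div_iff₀ hN]; nlinarith [(Nat.cast_nonneg N : (0 : ℝ) ≤ N)]) (by linarith)
    have h1 : 1 + (-1 / ((N : ℝ) + 1)) = N / (N + 1) := by field_simp; ring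
    rw [h1, Real.div_rpow (by positivity) hN.le, le_div_iff₀ (by positivity)] at hb
    have h2 : ((N : ℝ) + 1) ^ (p + 1) = (N + 1) ^ p * (N + 1) := Real.rpow_add_one hN.ne' p
    push_cast
    rw [div_add' _ _ _ (by positivity), div_le_div_iff_of_pos_right (by positivity)]
    have h3 : (1 + (p + 1) * (-1 / ((N : ℝ) + 1))) * (N + 1) ^ (p + 1) =
        (N + 1) ^ (p + 1) - (p + 1) * (N + 1) ^ p := by
      rw [h2]; field_simp; ring
    linarith

theorem dotProduct_comp_self_le {ι κ : Type*} [Fintype ι] [Fintype κ] (w : ι → ℝ) {g : κ → ι}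
    (hg : Function.Injective g) : (w ∘ g) ⬝ᵥ (w ∘ g) ≤ w ⬝ᵥ w := by
  classical
  calc (w ∘ g) ⬝ᵥ (w ∘ g) = ∑ x ∈ Finset.univ.map ⟨g, hg⟩, w x * w x := by
        simp [dotProduct]
    _ ≤ w ⬝ᵥ w := Finset.sum_le_sum_of_subset_of_nonneg (Finset.subset_univ _)
        fun x _ _ => mul_self_nonneg _

theorem real_dotProduct_self_nonneg {ι : Type*} [Fintype ι] (w : ι → ℝ) : 0 ≤ w ⬝ᵥ w :=
  Finset.sum_nonneg fun _ _ => mul_self_nonneg _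

theorem dotProduct_mulVec_conj_diagonal {N : ℕ} {Q : Matrix (Fin N) (Fin N) ℝ}
    (hQ : Qᵀ * Q = 1) (p c : Fin N → ℝ) :
    (Q *ᵥ c) ⬝ᵥ ((Q * diagonal p * Qᵀ) *ᵥ (Q *ᵥ c)) = ∑ a, p a * (c a * c a) := by
  rw [← mulVec_mulVec, mulVec_mulVec _ Qᵀ, hQ, one_mulVec, ← mulVec_mulVec, dotProduct_mulVec,
    ← mulVec_transpose, mulVec_mulVec, hQ, one_mulVec]
  refine Finset.sum_congr rfl fun a _ => ?_
  rw [mulVec_diagonal]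
  ring

theorem dotProduct_vecMul_submatrix_le {m n N k : ℕ} {κ : Type*} [Fintype κ]
    {M : Matrix (Fin m) (Fin n) ℝ} {U : Matrix (Fin n) (Fin n) ℝ} (hU : U * Uᵀ = 1)
    {d : Fin n → ℝ} (hdiag : Mᵀ * M = U * diagonal d * Uᵀ)
    {lam : ℕ → ℝ} (hlam : Antitone lam) (hlam0 : ∀ k, 0 < lam k) (hd : ∀ k : Fin n, d k ≤ lam k)
    {f : Fin N → Fin m} (hf : Function.Injective f) {g : κ → Fin n} (hg : Function.Injective g)
    {y : Fin N → ℝ}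
    (hy : ∀ j : Fin n, (j : ℕ) < k → (y ᵥ* (M.submatrix f id * U)) j = 0) :
    (y ᵥ* M.submatrix f g) ⬝ᵥ (y ᵥ* M.submatrix f g) ≤ lam k * (y ⬝ᵥ y) := by
  have hU' : Uᵀ * U = 1 := mul_eq_one_comm.1 hU
  set Y := M.submatrix f id with hY
  set u := y ᵥ* (Y * U) with hu
  have h1 : (y ᵥ* M.submatrix f g) ⬝ᵥ (y ᵥ* M.submatrix f g) ≤ u ⬝ᵥ u := by
    refine (dotProduct_comp_self_le (y ᵥ* Y) hg).trans_eq ?_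
    rw [hu, ← vecMul_vecMul, ← dotProduct_mulVec (y ᵥ* Y) U, ← vecMul_transpose U,
      vecMul_vecMul _ U, hU, vecMul_one]
  have h2 : u ⬝ᵥ u = y ⬝ᵥ (Y *ᵥ (U *ᵥ u)) := by
    rw [dotProduct_mulVec, dotProduct_mulVec, vecMul_vecMul]
  have h3 : (Y *ᵥ (U *ᵥ u)) ⬝ᵥ (Y *ᵥ (U *ᵥ u)) ≤ lam k * (u ⬝ᵥ u) := by
    refine (dotProduct_comp_self_le (M *ᵥ (U *ᵥ u)) hf).trans ?_
    have : (M *ᵥ (U *ᵥ u)) ⬝ᵥ (M *ᵥ (U *ᵥ u)) = ∑ j, d j * (u j * u j) := by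
      rw [← dotProduct_mulVec_conj_diagonal hU', ← hdiag, ← mulVec_mulVec,
        dotProduct_mulVec (U *ᵥ u), vecMul_transpose]
    rw [this, dotProduct, Finset.mul_sum]
    refine Finset.sum_le_sum fun j _ => ?_
    rcases lt_or_ge (j : ℕ) k with hj | hj
    · simp [hy j hj]
    · exact mul_le_mul_of_nonneg_right ((hd j).trans (hlam hj)) (mul_self_nonneg _)
  have h4 : (u ⬝ᵥ u) ^ 2 ≤ (y ⬝ᵥ y) * ((Y *ᵥ (U *ᵥ u)) ⬝ᵥ (Y *ᵥ (U *ᵥ u))) := by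
    rw [h2]
    simpa [dotProduct, sq] using
      Finset.sum_mul_sq_le_sq_mul_sq Finset.univ y (Y *ᵥ (U *ᵥ u))
  have hy0 := real_dotProduct_self_nonneg y
  rcases (real_dotProduct_self_nonneg u).eq_or_lt with h0 | h0
  · exact h1.trans (h0 ▸ mul_nonneg (hlam0 k).le hy0)
  · have : (u ⬝ᵥ u) * (u ⬝ᵥ u) ≤ (lam k * (y ⬝ᵥ y)) * (u ⬝ᵥ u) := by
      nlinarith [mul_le_mul_of_nonneg_left h3 hy0]
    exact h1.trans (le_of_mul_le_mul_right this h0)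

/-- Interlacing bound: for a submatrix `X` of `M` with independent rows, the trace of
`(X Xᵀ)⁻¹` is at least the sum of the inverses of upper bounds for the largest eigenvalues
of `Mᵀ M`. -/
theorem sum_inv_le_trace_inv {m n N : ℕ} (hNn : N ≤ n) {κ : Type*} [Fintype κ]
    {M : Matrix (Fin m) (Fin n) ℝ} {U : Matrix (Fin n) (Fin n) ℝ} (hU : U * Uᵀ = 1)
    {d : Fin n → ℝ} (hdiag : Mᵀ * M = U * diagonal d * Uᵀ)
    {lam : ℕ → ℝ} (hlam : Antitone lam) (hlam0 : ∀ k, 0 < lam k) (hd : ∀ k : Fin n, d k ≤ lam k)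
    {f : Fin N → Fin m} (hf : Function.Injective f) {g : κ → Fin n} (hg : Function.Injective g)
    (hP : (M.submatrix f g * (M.submatrix f g)ᵀ).PosDef) :
    ∑ k ∈ Finset.range N, (lam k)⁻¹ ≤ (M.submatrix f g * (M.submatrix f g)ᵀ)⁻¹.trace := by
  obtain ⟨Q, p, hp, hp0, hQ, hPQ⟩ := exists_antitone_orthogonal_diagonalization hP
  rw [hPQ, trace_inv_eq_sum hp0 hQ, Finset.sum_range]
  refine Finset.sum_le_sum fun k _ => inv_anti₀ (hp0 k) ?_
  set F := Qᵀ * (M.submatrix f id * U) with hF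
  let B : Matrix (Fin N) (Fin N) ℝ := Matrix.of fun a b =>
    if a < k then F b (Fin.castLE hNn a) else if a = k then 0 else (1 : Matrix _ _ ℝ) a b
  have hB : B.det = 0 := det_eq_zero_of_row_eq_zero k fun b => by simp [B]
  obtain ⟨c, hc0, hc⟩ := exists_mulVec_eq_zero_iff.2 hB
  have hc1 : ∀ a, k < a → c a = 0 := fun a ha => by
    have := congrFun hc a
    simpa [B, mulVec, dotProduct, ha.not_gt, ha.ne', Matrix.one_apply] using this
  have hc2 : ∀ j : Fin n, (j : ℕ) < k → ((Q *ᵥ c) ᵥ* (M.submatrix f id * U)) j = 0 := by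
    intro j hj
    have := congrFun hc ⟨j, hj.trans k.2⟩
    have hlt : (⟨j, hj.trans k.2⟩ : Fin N) < k := hj
    rw [← vecMul_transpose, vecMul_vecMul, ← hF]
    simpa [B, mulVec, vecMul, dotProduct, hlt, mul_comm] using this
  have key := dotProduct_vecMul_submatrix_le hU hdiag hlam hlam0 hd hf hg hc2
  have e1 : (Q *ᵥ c) ⬝ᵥ (Q *ᵥ c) = c ⬝ᵥ c := by
    rw [dotProduct_mulVec, ← mulVec_transpose, mulVec_mulVec, hQ, one_mulVec]
  have e2 : ((Q *ᵥ c) ᵥ* M.submatrix f g) ⬝ᵥ ((Q *ᵥ c) ᵥ* M.submatrix f g) =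
      ∑ a, p a * (c a * c a) := by
    rw [← dotProduct_mulVec_conj_diagonal hQ, ← hPQ, ← mulVec_mulVec,
      dotProduct_mulVec (Q *ᵥ c), mulVec_transpose]
  rw [e1, e2] at key
  have hcc : 0 < c ⬝ᵥ c := (real_dotProduct_self_nonneg c).lt_of_ne'
    fun h => hc0 (dotProduct_self_eq_zero.1 h)
  refine le_of_mul_le_mul_right (le_trans ?_ key) hcc
  rw [dotProduct, Finset.mul_sum]
  refine Finset.sum_le_sum fun a _ => ?_
  rcases lt_or_ge k a with ha | ha
  · simp [hc1 a ha]
  · exact mul_le_mul_of_nonneg_right (hp ha) (mul_self_nonneg _)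

/-- Summing the squared volumes of all submatrices obtained by deleting one column. -/
theorem sum_det_deleteCol {r q : ℕ} (X : Matrix (Fin r) (Fin (q + 1)) ℝ)
    (h : (X * Xᵀ).det ≠ 0) :
    ∑ j : Fin (q + 1), (X.submatrix id j.succAbove * (X.submatrix id j.succAbove)ᵀ).det =
      ((q : ℝ) + 1 - r) * (X * Xᵀ).det := by
  have hu : IsUnit (X * Xᵀ).det := isUnit_iff_ne_zero.2 h
  have hcol (j : Fin (q + 1)) :
      (X.submatrix id j.succAbove * (X.submatrix id j.succAbove)ᵀ).det =
        (X * Xᵀ).det * (1 - (Xᵀ * ((X * Xᵀ)⁻¹ * X)) j j) := by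
    have e : X.submatrix id j.succAbove * (X.submatrix id j.succAbove)ᵀ =
        X * Xᵀ + replicateCol Unit (-Xᵀ j) * replicateRow Unit (Xᵀ j) := by
      ext a b
      simp [Matrix.mul_apply, Fin.sum_univ_succAbove _ j]
    rw [e, det_add_replicateCol_mul_replicateRow hu, det_unique (n := Unit)]
    congr 1
    rw [Matrix.add_apply, one_apply_eq, sub_eq_add_neg]
    congr 1
    rw [Matrix.mul_assoc]
    simp [Matrix.mul_apply, Finset.sum_neg_distrib]
  simp_rw [hcol]
  rw [← Finset.mul_sum, Finset.sum_sub_distrib, mul_comm]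
  congr 1
  have : ∑ j, (Xᵀ * ((X * Xᵀ)⁻¹ * X)) j j = (r : ℝ) := by
    change (Xᵀ * ((X * Xᵀ)⁻¹ * X)).trace = _
    rw [trace_mul_comm, Matrix.mul_assoc, nonsing_inv_mul _ hu]
    simp
  rw [this]
  simp

theorem det_mul_transpose_self_nonneg {r : ℕ} {κ : Type*} [Fintype κ]
    (X : Matrix (Fin r) κ ℝ) : 0 ≤ (X * Xᵀ).det := by
  have := (posSemidef_self_mul_conjTranspose X).det_nonneg
  simpa using this

theorem mul_det_le_of_deleteCol_le {r q : ℕ} (hrq : r ≤ q) (X : Matrix (Fin r) (Fin (q + 1)) ℝ)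
    {v : ℝ} (hv : ∀ j : Fin (q + 1),
      (X.submatrix id j.succAbove * (X.submatrix id j.succAbove)ᵀ).det ≤ v) :
    (X * Xᵀ).det ≤ ((q : ℝ) + 1) / (q + 1 - r) * v := by
  have hrq' : (r : ℝ) ≤ q := by exact_mod_cast hrq
  have hpos : (0 : ℝ) < q + 1 - r := by linarith
  have hv0 : 0 ≤ v := (det_mul_transpose_self_nonneg _).trans (hv 0)
  rcases eq_or_ne (X * Xᵀ).det 0 with h | h
  · rw [h]; positivity
  · rw [div_mul_eq_mul_div, le_div_iff₀ hpos, mul_comm, ← sum_det_deleteCol X h]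
    refine (Finset.sum_le_sum fun j _ => hv j).trans_eq ?_
    simp

/-- Volume growth when the row `X 0` is added to the other rows, in terms of one entry `e` of the
residual. -/
theorem sq_mul_det_le_det_mul_transpose {r : ℕ} {κ : Type*} [Fintype κ]
    (X : Matrix (Fin (r + 1)) κ ℝ) (y b : Fin r → ℝ) (e : ℝ) (G : Matrix (Fin r) (Fin r) ℝ)
    (hG : G.PosDef)
    (hXG : X.submatrix Fin.succ id * (X.submatrix Fin.succ id)ᵀ = G + vecMulVec b b)
    (ht : X.submatrix Fin.succ id *ᵥ (X 0 - y ᵥ* X.submatrix Fin.succ id) = e • b)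
    (he : e ^ 2 ≤ (X 0 - y ᵥ* X.submatrix Fin.succ id) ⬝ᵥ
      (X 0 - y ᵥ* X.submatrix Fin.succ id)) :
    e ^ 2 * G.det ≤ (X * Xᵀ).det := by
  set A := X.submatrix Fin.succ id with hA
  set t := X 0 - y ᵥ* A with ht'
  set h := t ⬝ᵥ t with hh
  rcases eq_or_ne e 0 with rfl | he0
  · simpa using det_mul_transpose_self_nonneg X
  have hpos : 0 < h := (by positivity : 0 < e ^ 2).trans_le he
  let ε : Fin r ⊕ Unit ≃ Fin (r + 1) :=
    ((finSuccEquiv r).trans (Equiv.optionEquivSumPUnit (Fin r))).symm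
  have ε1 (a : Fin r) : ε (Sum.inl a) = a.succ := by simp [ε]
  have ε2 (a : Unit) : ε (Sum.inr a) = 0 := by simp [ε]
  let L : Matrix (Fin r ⊕ Unit) (Fin r ⊕ Unit) ℝ := fromBlocks 1 0 (replicateRow Unit y) 1
  let T : Matrix (Fin r ⊕ Unit) κ ℝ := fromRows A (replicateRow Unit t)
  have hL : L.det = 1 := by simp [L]
  have hX : X.submatrix ε id = L * T := by
    rw [fromBlocks_mul_fromRows]
    ext a k
    rcases a with a | a
    · simp [ε1, hA]
    · simp [ε2, ht', Matrix.add_apply, Matrix.mul_apply, vecMul, dotProduct]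
  have hT : T * Tᵀ = fromBlocks (G + vecMulVec b b) (replicateCol Unit (e • b))
      (replicateRow Unit (e • b)) (of fun _ _ => h) := by
    rw [transpose_fromRows, fromRows_mul_fromCols, hXG, ← ht]
    congr 1
    ext i j
    simp [Matrix.mul_apply, mulVec, dotProduct, mul_comm]
  have hdet : (X * Xᵀ).det = (T * Tᵀ).det := by
    rw [← det_submatrix_equiv_self ε, ← submatrix_mul_equiv X Xᵀ ε (Equiv.refl κ) ε,
      ← transpose_submatrix]
    simp only [Equiv.coe_refl]
    rw [hX, transpose_mul, Matrix.mul_assoc, ← Matrix.mul_assoc T, det_mul, det_mul,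
      det_transpose, hL]
    ring
  let : Invertible (of fun _ _ => h : Matrix Unit Unit ℝ) :=
    invertibleOfRightInverse _ (of fun _ _ => h⁻¹) (by
      ext i j; simp [Matrix.mul_apply, hpos.ne'])
  have hinv : ⅟(of fun _ _ => h : Matrix Unit Unit ℝ) = of fun _ _ => h⁻¹ := rfl
  set τ := 1 - e ^ 2 / h with hτ
  have hτ0 : 0 ≤ τ := sub_nonneg.2 ((div_le_one hpos).2 he)
  have hS : G + vecMulVec b b - replicateCol Unit (e • b) * (of fun _ _ => h⁻¹ : Matrix Unit Unit ℝ) *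
      replicateRow Unit (e • b) = G + replicateCol Unit (τ • b) * replicateRow Unit b := by
    ext i j
    simp [Matrix.mul_apply, vecMulVec_apply, hτ]
    ring
  have hq : 0 ≤ b ⬝ᵥ (G⁻¹ *ᵥ b) := by
    have := hG.inv.posSemidef.dotProduct_mulVec_nonneg b
    simpa using this
  have hone : (1 + replicateRow Unit b * G⁻¹ * replicateCol Unit (τ • b)).det =
      1 + τ * (b ⬝ᵥ (G⁻¹ *ᵥ b)) := by
    rw [det_unique (n := Unit), Matrix.add_apply, one_apply_eq, Matrix.mul_assoc]
    congr 1
    simp [Matrix.mul_apply, mulVec, dotProduct, Finset.mul_sum]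
    refine Finset.sum_congr rfl fun i _ => Finset.sum_congr rfl fun j _ => ?_
    ring
  rw [hdet, hT, det_fromBlocks₂₂, hinv, hS,
    det_add_replicateCol_mul_replicateRow (isUnit_iff_ne_zero.2 hG.det_pos.ne'), hone,
    det_unique (n := Unit), of_apply]
  have h1 := mul_le_mul_of_nonneg_right he hG.det_pos.le
  have h2 : 0 ≤ h * (G.det * (τ * (b ⬝ᵥ (G⁻¹ *ᵥ b)))) :=
    mul_nonneg hpos.le (mul_nonneg hG.det_pos.le (mul_nonneg hτ0 hq))
  linarith

theorem sq_le_of_det_bounds {m n r : ℕ} (hrn : r < n) {κ : Type*} [Fintype κ]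
    {M : Matrix (Fin m) (Fin n) ℝ} {U : Matrix (Fin n) (Fin n) ℝ} (hU : U * Uᵀ = 1)
    {d : Fin n → ℝ} (hdiag : Mᵀ * M = U * diagonal d * Uᵀ) {C s : ℝ} (hC : 0 < C) (hs : 0 < s)
    (hd : ∀ k : Fin n, d k ≤ C * ((k : ℝ) + 1) ^ (-(2 * s)))
    {f : Fin (r + 1) → Fin m} (hf : Function.Injective f)
    {g : κ → Fin n} (hg : Function.Injective g) {e K D : ℝ} (hD : 0 < D) (hK : 0 ≤ K)
    (hlow : e ^ 2 * D ≤ (M.submatrix f g * (M.submatrix f g)ᵀ).det)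
    (hup : ∀ i : Fin (r + 1), (M.submatrix (f ∘ i.succAbove) g *
      (M.submatrix (f ∘ i.succAbove) g)ᵀ).det ≤ K * D) :
    e ^ 2 ≤ K * C * (2 * s + 1) * ((r : ℝ) + 1) ^ (-(2 * s)) := by
  rcases eq_or_ne e 0 with rfl | he
  · rw [zero_pow two_ne_zero]; positivity
  set X := M.submatrix f g with hX
  have hdet : 0 < (X * Xᵀ).det := (by positivity : 0 < e ^ 2 * D).trans_le hlow
  have hpsd : (X * Xᵀ).PosSemidef := by
    simpa using posSemidef_self_mul_conjTranspose X
  have hP : (X * Xᵀ).PosDef := hpsd.posDef_iff_det_ne_zero.2 hdet.ne'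
  have htr := sum_inv_le_trace_inv (N := r + 1) hrn hU hdiag
    (lam := fun k => C * ((k : ℝ) + 1) ^ (-(2 * s)))
    (fun a b hab => mul_le_mul_of_nonneg_left
      (Real.rpow_le_rpow_of_nonpos (by positivity) (by gcongr) (by linarith)) hC.le)
    (fun k => by positivity) hd hf hg hP
  have hsum : ((r : ℝ) + 1) ^ (2 * s + 1) / (2 * s + 1) / C ≤
      ∑ k ∈ Finset.range (r + 1), (C * ((k : ℝ) + 1) ^ (-(2 * s)))⁻¹ := by
    have h := rpow_div_le_sum_rpow (p := 2 * s) (by positivity) (r + 1)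
    push_cast at h
    rw [div_le_iff₀ hC, Finset.sum_mul]
    refine h.trans (Finset.sum_le_sum fun k _ => ?_)
    rw [Real.rpow_neg (by positivity), mul_inv, inv_inv]
    field_simp
    rfl
  have hall : (X * Xᵀ).det * (X * Xᵀ)⁻¹.trace ≤ ((r : ℝ) + 1) * (K * D) := by
    rw [mul_sum_inv_trace X hdet.ne']
    refine (Finset.sum_le_sum fun i _ => hup i).trans_eq ?_
    simp
  have hS := hsum.trans htr
  have hR : (0 : ℝ) < r + 1 := by positivity
  have hpow : ((r : ℝ) + 1) ^ (2 * s + 1) = (r + 1) ^ (2 * s) * (r + 1) :=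
    Real.rpow_add_one hR.ne' _
  set S := ((r : ℝ) + 1) ^ (2 * s + 1) / (2 * s + 1) / C with hSdef
  have hS0 : 0 < S := by positivity
  have h1 : e ^ 2 * S ≤ (r + 1) * K := by
    refine le_of_mul_le_mul_right ?_ hD
    calc e ^ 2 * S * D = e ^ 2 * D * S := by ring
      _ ≤ (X * Xᵀ).det * S := mul_le_mul_of_nonneg_right hlow hS0.le
      _ ≤ (X * Xᵀ).det * (X * Xᵀ)⁻¹.trace := mul_le_mul_of_nonneg_left hS hdet.le
      _ ≤ _ := hall
      _ = _ := by ring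
  rw [← le_div_iff₀ hS0] at h1
  refine h1.trans_eq ?_
  rw [hSdef, hpow, Real.rpow_neg hR.le]
  field_simp

theorem isUnit_of_rank_eq {r : ℕ} {G : Matrix (Fin r) (Fin r) ℝ} (h : G.rank = r) :
    IsUnit G := by
  rw [← mulVec_surjective_iff_isUnit]
  refine LinearMap.range_eq_top.1 (Submodule.eq_top_of_finrank_eq (?_ : G.rank = _))
  simp [h]

theorem cons_castLE_injective {a b : ℕ} (h : a ≤ b) {i : Fin b} (hi : a ≤ i) :
    Function.Injective (Fin.cons i (Fin.castLE h) : Fin (a + 1) → Fin b) := by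
  refine Fin.cons_injective_iff.2 ⟨?_, Fin.castLE_injective h⟩
  rintro ⟨x, rfl⟩
  exact absurd x.2 (not_lt.2 hi)

/-- Corollary 2 of Theorem 4: Let `M ∈ ℝ^{m×n}` with `rank M ≥ r+1` and
singular values `σ₁ ≥ σ₂ ≥ ...` (encoded by an orthogonal diagonalisation of `Mᵀ M`)
satisfying `C₁ k^{−2s} ≤ σ_k² ≤ C₂ k^{−2s}` for all `k`. Let `q = α·r − 1` for a rational
`α > 1`, write `M = [[A, B],[C, D]]` with `A ∈ ℝ^{r×q}` of rank `r` and `det (A Aᵀ)`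
maximal among all `r×q` submatrices of `M`, and let `M̂ = [A; C] A⁺ [A, B]` with
`A⁺ = Aᵀ (A Aᵀ)⁻¹`. Then `‖M̂ − M‖_C² ≤ (α/(α−1))·(C₂/C₁)·(2s+1)·σ_{r+1}²`. -/
theorem maxvol_pseudo_skeleton_error_sq_le_of_power_decay
    (m n r q : ℕ) (hrq : r ≤ q) (hrm : r ≤ m) (hqn : q ≤ n) (hrn : r < n)
    (M : Matrix (Fin m) (Fin n) ℝ) (hrank : r + 1 ≤ M.rank)
    (σ : Fin n → ℝ) (hanti : Antitone σ)
    (U : Matrix (Fin n) (Fin n) ℝ) (hU : U * Uᵀ = 1)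
    (hdiag : Mᵀ * M = U * Matrix.diagonal (fun k => σ k ^ 2) * Uᵀ)
    (C₁ C₂ s : ℝ) (hC₁ : 0 < C₁) (hC₂ : 0 < C₂) (hs : 0 < s)
    (hdecay : ∀ k : Fin n,
      C₁ * ((k : ℝ) + 1) ^ (-(2 * s)) ≤ σ k ^ 2 ∧
        σ k ^ 2 ≤ C₂ * ((k : ℝ) + 1) ^ (-(2 * s)))
    (α : ℚ) (hα : 1 < α) (hq : (q : ℚ) = α * r - 1)
    (A : Matrix (Fin r) (Fin q) ℝ)
    (hA : A = M.submatrix (Fin.castLE hrm) (Fin.castLE hqn))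
    (hArank : A.rank = r)
    (hmax : ∀ (f : Fin r → Fin m) (g : Fin q → Fin n),
      Function.Injective f → Function.Injective g →
      ((M.submatrix f g) * (M.submatrix f g)ᵀ).det ≤ (A * Aᵀ).det)
    (Mhat : Matrix (Fin m) (Fin n) ℝ)
    (hMhat : Mhat =
      M.submatrix id (Fin.castLE hqn) * (Aᵀ * (A * Aᵀ)⁻¹) * M.submatrix (Fin.castLE hrm) id) :
    ∀ i j, |(Mhat - M) i j| ^ 2 ≤
      ((α : ℝ) / ((α : ℝ) - 1)) * (C₂ / C₁) * (2 * s + 1) * σ ⟨r, hrn⟩ ^ 2 := by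
  have hr : 0 < r := by
    rcases Nat.eq_zero_or_pos r with rfl | h
    · have : (0 : ℚ) ≤ q := Nat.cast_nonneg q
      simp only [Nat.cast_zero, mul_zero] at hq
      linarith
    · exact h
  have hrR : (0 : ℝ) < r := by exact_mod_cast hr
  have hqR : (q : ℝ) = α * r - 1 := by exact_mod_cast congrArg (Rat.cast : ℚ → ℝ) hq
  have hαR : (1 : ℝ) < α := by exact_mod_cast hα
  have hK : ((q : ℝ) + 1) / (q + 1 - r) = α / (α - 1) := by
    have : (α : ℝ) - 1 ≠ 0 := by linarith
    rw [hqR, show (α : ℝ) * r - 1 + 1 - r = (α - 1) * r by ring, sub_add_cancel]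
    field_simp
  have hK1 : 1 ≤ (α : ℝ) / (α - 1) := by
    rw [le_div_iff₀ (by linarith)]; linarith
  intro i j
  suffices h : |(Mhat - M) i j| ^ 2 ≤
      ((α : ℝ) / (α - 1)) * C₂ * (2 * s + 1) * ((r : ℝ) + 1) ^ (-(2 * s)) by
    refine h.trans ?_
    have h1 := (hdecay ⟨r, hrn⟩).1
    calc ((α : ℝ) / (α - 1)) * C₂ * (2 * s + 1) * ((r : ℝ) + 1) ^ (-(2 * s))
        = ((α : ℝ) / (α - 1)) * (C₂ / C₁) * (2 * s + 1) *
            (C₁ * ((r : ℝ) + 1) ^ (-(2 * s))) := by field_simp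
      _ ≤ _ := mul_le_mul_of_nonneg_left h1 (by positivity)
  set G := A * Aᵀ with hGdef
  have hGpsd : G.PosSemidef := by simpa using posSemidef_self_mul_conjTranspose A
  have hG : G.PosDef := hGpsd.posDef_iff_isUnit.2
    (isUnit_of_rank_eq (by rw [hGdef, rank_self_mul_transpose, hArank]))
  have hGu : IsUnit G.det := isUnit_iff_ne_zero.2 hG.det_pos.ne'
  have hGt : Gᵀ = G := by simp [hGdef]
  set c : Fin q → ℝ := fun k => M i (Fin.castLE hqn k) with hc
  set y : Fin r → ℝ := c ᵥ* (Aᵀ * G⁻¹) with hy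
  have hentry : Mhat i j = y ⬝ᵥ fun a => M (Fin.castLE hrm a) j := by
    rw [hMhat, Matrix.mul_apply_eq_vecMul]
    rfl
  have hAt : A *ᵥ (c - y ᵥ* A) = 0 := by
    have hyG : G *ᵥ y = A *ᵥ c := by
      rw [hy, ← vecMul_transpose G, hGt, vecMul_vecMul, Matrix.mul_assoc,
        nonsing_inv_mul _ hGu, Matrix.mul_one, vecMul_transpose]
    rw [mulVec_sub, ← hyG, ← mulVec_transpose, mulVec_mulVec, sub_self]
  rw [sq_abs, Matrix.sub_apply, ← neg_sq, neg_sub]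
  rcases lt_or_ge (i : ℕ) r with hi | hi
  · have hyi : y = Pi.single ⟨i, hi⟩ 1 := by
      have hcA : c = Pi.single ⟨i, hi⟩ 1 ᵥ* A := by
        rw [single_one_vecMul, hA]; rfl
      rw [hy, hcA, vecMul_vecMul, ← Matrix.mul_assoc, mul_nonsing_inv _ hGu, vecMul_one]
    have : M i j - Mhat i j = 0 := by
      rw [hentry, hyi, single_one_dotProduct]; exact sub_self _
    rw [this, zero_pow two_ne_zero]
    positivity
  have hf := cons_castLE_injective hrm hi
  rcases lt_or_ge (j : ℕ) q with hj | hj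
  · have hs1 : (M.submatrix (Fin.cons i (Fin.castLE hrm)) (Fin.castLE hqn)).submatrix
        Fin.succ id = A := by
      rw [hA]; rfl
    refine sq_le_of_det_bounds hrn hU hdiag hC₂ hs (fun k => (hdecay k).2) hf
      (Fin.castLE_injective hqn) hG.det_pos (by positivity) ?_ ?_
    · refine sq_mul_det_le_det_mul_transpose _ y 0 _ G hG ?_ ?_ ?_
      · rw [hs1]; simp [hGdef]
      · rw [hs1, smul_zero]; exact hAt
      · rw [hs1]
        have ht : M i j - Mhat i j = (c - y ᵥ* A) ⟨j, hj⟩ := by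
          rw [hentry, hA]; rfl
        rw [ht, sq]
        exact Finset.single_le_sum
          (f := fun k => (c - y ᵥ* A) k * (c - y ᵥ* A) k)
          (fun k _ => mul_self_nonneg _) (Finset.mem_univ _)
    · intro l
      refine (hmax _ _ (hf.comp Fin.succAbove_right_injective)
        (Fin.castLE_injective hqn)).trans ?_
      exact le_mul_of_one_le_left hG.det_pos.le hK1
  · have hg := cons_castLE_injective hqn hj
    set b : Fin r → ℝ := fun a => M (Fin.castLE hrm a) j with hb
    set X := M.submatrix (Fin.cons i (Fin.castLE hrm) : Fin (r + 1) → Fin m)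
      (Fin.cons j (Fin.castLE hqn) : Fin (q + 1) → Fin n) with hX
    have hX0 (a : Fin r) : X.submatrix Fin.succ id a 0 = b a := rfl
    have hXs (a : Fin r) (k : Fin q) : X.submatrix Fin.succ id a k.succ = A a k := by
      rw [hA]; rfl
    have ht0 : (X 0 - y ᵥ* X.submatrix Fin.succ id) 0 = M i j - Mhat i j := by
      rw [hentry]; rfl
    have hts (k : Fin q) : (X 0 - y ᵥ* X.submatrix Fin.succ id) k.succ = (c - y ᵥ* A) k := by
      rw [hA]; rfl
    refine sq_le_of_det_bounds hrn hU hdiag hC₂ hs (fun k => (hdecay k).2) hf hg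
      hG.det_pos (by positivity) ?_ ?_
    · refine sq_mul_det_le_det_mul_transpose _ y b _ G hG ?_ ?_ ?_
      · ext a a'
        rw [← hX, Matrix.mul_apply, Fin.sum_univ_succ, add_comm]
        simp only [transpose_apply, hX0, hXs]
        rfl
      · ext a
        rw [← hX, mulVec, dotProduct, Fin.sum_univ_succ]
        simp only [ht0, hts, hX0, hXs]
        have := congrFun hAt a
        rw [mulVec, dotProduct] at this
        rw [this]
        simp [mul_comm]
      · rw [← hX, dotProduct, Fin.sum_univ_succ, ht0, sq]
        exact le_add_of_nonneg_right (Finset.sum_nonneg fun k _ => mul_self_nonneg _)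
    · intro l
      rw [← hK]
      refine mul_det_le_of_deleteCol_le hrq _ fun k => ?_
      exact hmax _ _ (hf.comp Fin.succAbove_right_injective)
        (hg.comp Fin.succAbove_right_injective)
end
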